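/- arXiv:1410.8780 — 8 statements merged into one kernel-verified Lean document; each statement's English description precedes it below -/
import Mathlib

section
/- Let S be a conormal skew lattice and let b, c ∈ S with b ⪯ c in the natural preorder. Then there exists a unique element a ∈ S such that a D c and b ≤ a in the natural partial order. -/
/-- A skew lattice: both operations idempotent, associative, with the four absorption laws. -/
structure SkewLattice (S : Type*) where
  m : S → S → S  -- meet ∧
  j : S → S → S  -- join ∨
  m_idem : ∀ x, m x x = x
  j_idem : ∀ x, j x x = x
  m_assoc : ∀ x y z, m (m x y) z = m x (m y z)
  j_assoc : ∀ x y z, j (j x y) z = j x (j y z)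
  abs1 : ∀ x y, m x (j x y) = x
  abs2 : ∀ x y, j x (m x y) = x
  abs3 : ∀ x y, j (m x y) y = y
  abs4 : ∀ x y, m (j x y) y = y

namespace SkewLattice

variable {S : Type*}

/-- Natural partial order: x ≤ y iff x∨y = y = y∨x. -/
def nle (L : SkewLattice S) (x y : S) : Prop := L.j x y = y ∧ L.j y x = y

/-- Natural preorder: x ⪯ y iff y∨x∨y = y. -/
def npre (L : SkewLattice S) (x y : S) : Prop := L.j (L.j y x) y = y

/-- Green's relation D: x D y iff x ⪯ y and y ⪯ x. -/
def dRel (L : SkewLattice S) (x y : S) : Prop := L.npre x y ∧ L.npre y x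

/-- Green's relation L. -/
def lRel (L : SkewLattice S) (x y : S) : Prop := L.m x y = x ∧ L.m y x = y

/-- Green's relation R. -/
def rRel (L : SkewLattice S) (x y : S) : Prop := L.m x y = y ∧ L.m y x = x

/-- Co-strong distributivity. -/
def CoStronglyDistributive (L : SkewLattice S) : Prop :=
  (∀ x y z, L.j x (L.m y z) = L.m (L.j x y) (L.j x z)) ∧
  (∀ x y z, L.j (L.m x y) z = L.m (L.j x z) (L.j y z))

/-- Conormality: x∨y∨z∨w = x∨z∨y∨w. -/
def Conormal (L : SkewLattice S) : Prop :=
  ∀ x y z w, L.j (L.j (L.j x y) z) w = L.j (L.j (L.j x z) y) w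

/-- t is a top: x∨t = t = t∨x for all x. -/
def IsTop (L : SkewLattice S) (t : S) : Prop := ∀ x, L.j x t = t ∧ L.j t x = t

/-- `h` is a skew Heyting implication for the skew lattice `L`:
(i) x→y = (y∨x∨y)→y, and (ii) whenever y ≤ x, x→y is the greatest element w
of the upset y↑ satisfying w∧x ≤ y. -/
def IsSkewHeytingImp (L : SkewLattice S) (h : S → S → S) : Prop :=
  (∀ x y, h x y = h (L.j (L.j y x) y) y) ∧
  (∀ x y, L.nle y x →
     L.nle y (h x y) ∧ L.nle (L.m (h x y) x) y ∧
     ∀ w, L.nle y w → L.nle (L.m w x) y → L.nle w (h x y))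

end SkewLattice

open SkewLattice

/-- A skew Heyting algebra: a co-strongly distributive skew lattice with top 1 together
with an implication satisfying (i) and (ii) above. -/
structure SkewHeytingAlgebra (S : Type*) extends SkewLattice S where
  himp : S → S → S
  one : S
  costrong : toSkewLattice.CoStronglyDistributive
  top : toSkewLattice.IsTop one
  himp_spec : toSkewLattice.IsSkewHeytingImp himp

/-- in a conormal skew lattice, if b ⪯ c then there is a unique a
with a D c and b ≤ a. -/
theorem stmt_1 {S : Type*} (L : SkewLattice S) (hco : L.Conormal) (b c : S)
    (hbc : L.npre b c) :
    ∃! a : S, L.dRel a c ∧ L.nle b a := by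
  have assoc := L.j_assoc
  have idem := L.j_idem
  have cancel : ∀ x y, L.j x (L.j x y) = L.j x y := fun x y => by rw [← assoc, idem]
  simp only [Conormal, dRel, npre, nle, assoc] at hco hbc ⊢
  have hbc' : ∀ x, L.j c (L.j b (L.j c x)) = L.j c x := fun x => by
    rw [← assoc b, ← assoc c, hbc]
  refine ⟨L.j b (L.j c b), ⟨⟨?_, ?_⟩, ?_, ?_⟩, ?_⟩
  · simp only [assoc, hbc]
  · simp only [assoc, hbc']
  · simp only [cancel]
  · simp only [assoc, idem]
  · rintro a ⟨⟨hca, hac⟩, hba, hab⟩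
    calc a = L.j (L.j b (L.j a (L.j c a))) b := by rw [hac, hba, hab]
      _ = L.j b (L.j c (L.j a b)) := by
        rw [assoc, assoc, assoc, ← cancel a b, hco b c a (L.j a b), cancel]
      _ = L.j b (L.j (L.j c (L.j a c)) b) := by
        rw [assoc, assoc, hco c a c b, cancel]
      _ = L.j b (L.j c b) := by rw [hca]
end

section
/- Let S be a conormal skew lattice, let u ∈ S, and let x, y ∈ S satisfy u ≤ x and u ≤ y in the natural partial order. Then x∧y = y∧x, x∨y = y∨x, u ≤ x∧y and u ≤ x∨y; that is, the upset u↑ = {x ∈ S : u ≤ x} is closed under ∧ and ∨ and forms a commutative lattice with bottom u under the induced operations. -/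
open SkewLattice

namespace SkewLattice

variable {S : Type*} {L : SkewLattice S}

theorem nle_of_meet {x y : S} (h₁ : L.m x y = x) (h₂ : L.m y x = x) : L.nle x y := by
  refine ⟨?_, ?_⟩
  · simpa only [h₁] using L.abs3 x y
  · simpa only [h₂] using L.abs2 y x

theorem nle.meet_left {x y : S} (h : L.nle x y) : L.m x y = x := by
  simpa only [h.1] using L.abs1 x y

theorem nle.meet_right {x y : S} (h : L.nle x y) : L.m y x = x := by
  simpa only [h.2] using L.abs4 y x

theorem nle.meet {u x y : S} (hx : L.nle u x) (hy : L.nle u y) : L.nle u (L.m x y) :=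
  nle_of_meet (by rw [← L.m_assoc, hx.meet_left, hy.meet_left])
    (by rw [L.m_assoc, hy.meet_right, hx.meet_right])

theorem nle.join {u x y : S} (hx : L.nle u x) (hy : L.nle u y) : L.nle u (L.j x y) :=
  ⟨by rw [← L.j_assoc, hx.1], by rw [L.j_assoc, hy.2]⟩

theorem Conormal.join_comm_of_nle (hco : L.Conormal) {u x y : S} (hx : L.nle u x)
    (hy : L.nle u y) : L.j x y = L.j y x := by
  have h := hco u x y u
  rwa [hx.1, hy.1, L.j_assoc, L.j_assoc, hy.2, hx.2] at h

/-- In an upset of a conormal skew lattice, `a ∧ b ∧ a = a` forces `a ∨ b = b`. -/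
theorem Conormal.join_eq_right_of_nle (hco : L.Conormal) {u a b : S} (ha : L.nle u a)
    (hb : L.nle u b) (hab : L.m (L.m a b) a = a) : L.j a b = b := by
  have hca : L.j (L.m a b) a = L.m a b := by
    simpa only [hab] using L.abs2 (L.m a b) a
  have hac : L.j a (L.m a b) = a := L.abs2 a b
  have hcomm := hco.join_comm_of_nle ha (ha.meet hb)
  have hc : L.m a b = a := by rw [← hca, ← hcomm, hac]
  simpa only [hc] using L.abs3 a b

theorem meet_meet_swap_meet (x y : S) :
    L.m (L.m (L.m x y) (L.m y x)) (L.m x y) = L.m x y := by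
  calc L.m (L.m (L.m x y) (L.m y x)) (L.m x y)
      = L.m (L.m x (L.m y y)) (L.m (L.m x x) y) := by simp only [L.m_assoc]
    _ = L.m x y := by rw [L.m_idem, L.m_idem, L.m_idem]

theorem Conormal.meet_comm_of_nle (hco : L.Conormal) {u x y : S} (hx : L.nle u x)
    (hy : L.nle u y) : L.m x y = L.m y x := by
  have ha := hx.meet hy
  have hb := hy.meet hx
  rw [← hco.join_eq_right_of_nle hb ha (meet_meet_swap_meet y x),
    hco.join_comm_of_nle hb ha, hco.join_eq_right_of_nle ha hb (meet_meet_swap_meet x y)]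

end SkewLattice

/-- in a conormal skew lattice each upset u↑ is closed under ∧, ∨ and
is commutative (with bottom u). -/
theorem stmt_2 {S : Type*} (L : SkewLattice S) (hco : L.Conormal) (u x y : S)
    (hx : L.nle u x) (hy : L.nle u y) :
    L.m x y = L.m y x ∧ L.j x y = L.j y x ∧ L.nle u (L.m x y) ∧ L.nle u (L.j x y) :=
  ⟨hco.meet_comm_of_nle hx hy, hco.join_comm_of_nle hx hy, hx.meet hy, hx.join hy⟩
end

section
/- Let S be a co-strongly distributive skew lattice with top 1, and let u, x, y ∈ S with u ≤ x and u ≤ y in the natural partial order. Suppose a ∈ S is the greatest element of the set {w ∈ S : u ≤ w and w∧x ≤ y} and b ∈ S is the greatest element of the set {w ∈ S : y ≤ w and w∧(y∨x∨y) ≤ y} (greatest with respect to the natural partial order). Then a = b. (The Heyting implication x→_u y computed in the upset u↑ agrees with (y∨x∨y)→_y y computed in y↑.) -/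
open SkewLattice

namespace SkewLattice

variable {S : Type*} {L : SkewLattice S} {u x y z : S}

theorem nle.trans (hxy : L.nle x y) (hyz : L.nle y z) : L.nle x z := by
  constructor
  · rw [← hyz.1, ← L.j_assoc, hxy.1]
  · rw [← hyz.2, L.j_assoc, hxy.2]

theorem nle.antisymm (hxy : L.nle x y) (hyx : L.nle y x) : x = y :=
  hyx.2.symm.trans hxy.1

theorem nle.m_eq_left (h : L.nle x y) : L.m x y = x := by
  rw [← h.1, L.abs1]

theorem nle.m_eq_right (h : L.nle x y) : L.m y x = x := by
  rw [← h.2, L.abs4]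

theorem nle.le_j (hx : L.nle u x) (hy : L.nle u y) : L.nle u (L.j x y) := by
  constructor
  · rw [← L.j_assoc, hx.1]
  · rw [L.j_assoc, hy.2]

theorem CoStronglyDistributive.le_m (hcs : L.CoStronglyDistributive)
    (hx : L.nle u x) (hy : L.nle u y) : L.nle u (L.m x y) := by
  constructor
  · rw [hcs.1, hx.1, hy.1]
  · rw [hcs.2, hx.2, hy.2]

/-- Joins commute in the principal filter of `u`. -/
theorem CoStronglyDistributive.j_comm (hcs : L.CoStronglyDistributive)
    (hx : L.nle u x) (hy : L.nle u y) : L.j x y = L.j y x := by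
  have absorb : ∀ {p q}, L.nle u p → L.nle u q →
      L.m (L.j p q) p = p ∧ L.m p (L.j q p) = p := by
    intro p q hp hq
    constructor
    · have h := hcs.1 p q u
      rwa [hq.m_eq_right, hp.2, eq_comm] at h
    · have h := hcs.2 u q p
      rwa [hq.m_eq_left, hp.1, eq_comm] at h
  have h₁ : L.j (L.j x y) x = L.j x y := by
    have h := L.abs2 (L.j x y) x
    rwa [(absorb hx hy).1] at h
  have h₂ : L.j x (L.j y x) = L.j y x := by
    have h := L.abs3 x (L.j y x)
    rwa [(absorb hx hy).2] at h
  rw [← h₁, L.j_assoc, h₂]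

theorem CoStronglyDistributive.m_le_left (hcs : L.CoStronglyDistributive)
    (hx : L.nle u x) (hy : L.nle u y) : L.nle (L.m x y) x :=
  ⟨(hcs.j_comm (hcs.le_m hx hy) hx).trans (L.abs2 x y), L.abs2 x y⟩

end SkewLattice

/-- the Heyting implication x→_u y computed in u↑ agrees with
(y∨x∨y)→_y y computed in y↑. -/
theorem stmt_5 {S : Type*} (L : SkewLattice S) (one : S)
    (hcs : L.CoStronglyDistributive) (htop : L.IsTop one)
    (u x y a b : S) (hux : L.nle u x) (huy : L.nle u y)
    (ha1 : L.nle u a ∧ L.nle (L.m a x) y)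
    (ha2 : ∀ w, L.nle u w → L.nle (L.m w x) y → L.nle w a)
    (hb1 : L.nle y b ∧ L.nle (L.m b (L.j (L.j y x) y)) y)
    (hb2 : ∀ w, L.nle y w → L.nle (L.m w (L.j (L.j y x) y)) y → L.nle w b) :
    a = b := by
  obtain ⟨hua, hax⟩ := ha1
  obtain ⟨hyb, hbt⟩ := hb1
  have hub := huy.trans hyb
  have huyx := huy.le_j hux
  have hyxy : L.j (L.j y x) y = L.j y x := by
    rw [L.j_assoc, hcs.j_comm hux huy, ← L.j_assoc, L.j_idem]
  rw [hyxy] at hbt hb2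
  have hx_yx : L.nle x (L.j y x) :=
    ⟨by rw [hcs.j_comm huy hux, ← L.j_assoc, L.j_idem], by rw [L.j_assoc, L.j_idem]⟩
  have hya : L.nle y a := ha2 y huy (hcs.m_le_left huy hux)
  refine nle.antisymm (hb2 a hya ?_) (ha2 b hub ?_)
  · have h := hcs.1 y a x
    rw [hax.2, hya.1] at h
    rw [← h]
    exact ⟨L.j_idem y, L.j_idem y⟩
  · have h : L.m b x = L.m (L.m b (L.j y x)) x := by
      rw [L.m_assoc, hx_yx.m_eq_right]
    rw [h]
    exact (hcs.m_le_left (hcs.le_m hub huyx) hux).trans hbt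
end

section
/- Let (S;∧,∨,1) be a co-strongly distributive skew lattice with top 1 and let → be a binary operation on S satisfying: (SH0) x→y = (y∨x∨y)→y; (SH1) x→x = 1; (SH2) x∧(x→y)∧x = x∧y∧x; (SH3) y∧(x→y) = y and (x→y)∧y = y; (SH4) x→(u∨(y∧z)∨u) = (x→(u∨y∨u))∧(x→(u∨z∨u)). Then (S;∧,∨,→,1) is a skew Heyting algebra; in particular, whenever y ≤ x in the natural partial order, x→y is the greatest element w with y ≤ w satisfying w∧x ≤ y. -/
open SkewLattice

namespace SkewLattice

variable {S : Type*} (L : SkewLattice S)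

theorem nle_iff_meet {x y : S} : L.nle x y ↔ L.m x y = x ∧ L.m y x = x := by
  constructor
  · rintro ⟨h₁, h₂⟩
    refine ⟨?_, ?_⟩
    · simpa [h₁] using L.abs1 x y
    · simpa [h₂] using L.abs4 y x
  · rintro ⟨h₁, h₂⟩
    refine ⟨?_, ?_⟩
    · simpa [h₁] using L.abs3 x y
    · simpa [h₂] using L.abs2 y x

theorem nle_refl (x : S) : L.nle x x := ⟨L.j_idem x, L.j_idem x⟩

theorem nle_meet (hcs : L.CoStronglyDistributive) {x y z : S}
    (hy : L.nle x y) (hz : L.nle x z) : L.nle x (L.m y z) :=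
  ⟨by rw [hcs.1, hy.1, hz.1], by rw [hcs.2, hy.2, hz.2]⟩

theorem nle_antisymm {x y : S} (hxy : L.nle x y) (hyx : L.nle y x) : x = y :=
  hyx.2.symm.trans hxy.1

theorem join_join_of_nle {x y : S} (hxy : L.nle x y) : L.j (L.j x y) x = y := by
  rw [hxy.1, hxy.2]

theorem meet_top {t : S} (ht : L.IsTop t) (x : S) : L.m x t = x := by
  simpa [(ht x).1] using L.abs1 x t

/-- Inside an upset, a meet is determined by its conjugate `x ∧ w ∧ x` when this is the bottom. -/
theorem meet_eq_of_meet_meet_eq (hcs : L.CoStronglyDistributive) {w x y : S}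
    (hw : L.nle y w) (hx : L.nle y x) (h : L.m (L.m x w) x = y) : L.m w x = y := by
  have hle := (L.nle_iff_meet.1 (L.nle_meet hcs hw hx)).2
  calc L.m w x = L.m (L.m w x) (L.m w x) := (L.m_idem _).symm
    _ = L.m (L.m w (L.m x x)) (L.m w x) := by rw [L.m_idem x]
    _ = L.m (L.m w x) (L.m (L.m x w) x) := by simp only [L.m_assoc]
    _ = y := by rw [h, hle]

end SkewLattice

/-- a co-strongly distributive skew lattice with top 1 and a binary
operation → satisfying (SH0)-(SH4) is a skew Heyting algebra. -/
theorem stmt_7 {S : Type*} (L : SkewLattice S) (one : S) (h : S → S → S)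
    (hcs : L.CoStronglyDistributive) (htop : L.IsTop one)
    (sh0 : ∀ x y, h x y = h (L.j (L.j y x) y) y)
    (sh1 : ∀ x, h x x = one)
    (sh2 : ∀ x y, L.m (L.m x (h x y)) x = L.m (L.m x y) x)
    (sh3 : ∀ x y, L.m y (h x y) = y ∧ L.m (h x y) y = y)
    (sh4 : ∀ x y z u, h x (L.j (L.j u (L.m y z)) u) =
      L.m (h x (L.j (L.j u y) u)) (h x (L.j (L.j u z) u))) :
    L.IsSkewHeytingImp h := by
  refine ⟨sh0, fun x y hyx => ?_⟩
  have hle : ∀ a b, L.nle b (h a b) := fun a b => L.nle_iff_meet.2 (sh3 a b)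
  refine ⟨hle x y, ?_, fun w hyw hwx => ?_⟩
  · have hy : L.m (L.m x (h x y)) x = y := by
      rw [sh2, (L.nle_iff_meet.1 hyx).2, (L.nle_iff_meet.1 hyx).1]
    rw [L.meet_eq_of_meet_meet_eq hcs (hle x y) hyx hy]
    exact L.nle_refl y
  · have hmeet : L.m w x = y := L.nle_antisymm hwx (L.nle_meet hcs hyw hyx)
    have himp : h x y = h x w := by
      simpa [hmeet, L.j_idem, L.join_join_of_nle hyw, L.join_join_of_nle hyx, sh1,
        L.meet_top htop] using sh4 x w x y
    rw [himp]
    exact hle x w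
end

section
/- Let (S;∧,∨,1) be a co-strongly distributive skew lattice with top 1 and let → be a binary operation on S satisfying x→y = (y∨x∨y)→y for all x, y. Then for all x, u, w ∈ S: x→(u∨w∨u) = (u∨x∨u)→(u∨w∨u). -/
open SkewLattice

/-- (SH0) implies x→(u∨w∨u) = (u∨x∨u)→(u∨w∨u). -/
theorem stmt_8 {S : Type*} (L : SkewLattice S) (one : S) (h : S → S → S)
    (hcs : L.CoStronglyDistributive) (htop : L.IsTop one)
    (sh0 : ∀ x y, h x y = h (L.j (L.j y x) y) y)
    (x u w : S) :
    h x (L.j (L.j u w) u) = h (L.j (L.j u x) u) (L.j (L.j u w) u) := by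
  have idem_left : ∀ a, L.j u (L.j u a) = L.j u a := fun a => by
    rw [← L.j_assoc, L.j_idem]
  rw [sh0 x, sh0 (L.j (L.j u x) u)]
  simp only [L.j_assoc, idem_left]
end

section
/- Let S be a skew lattice and let b, d, x ∈ S satisfy b D d and b ≤ x in the natural partial order. Then x D (d∨x∨d). -/
open SkewLattice

/-- if b D d and b ≤ x then x D (d∨x∨d). -/
theorem stmt_11 {S : Type*} (L : SkewLattice S) (b d x : S)
    (hbd : L.dRel b d) (hbx : L.nle b x) :
    L.dRel x (L.j (L.j d x) d) := by
  have hxdx : L.j x (L.j d x) = x := by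
    have h : L.j b (L.j d (L.j b x)) = L.j b x := by
      simpa only [L.j_assoc] using congrArg (fun t => L.j t x) hbd.2
    have h' := congrArg (L.j x) h
    rwa [← L.j_assoc x b, hbx.1, hbx.2, L.j_idem] at h'
  have hidem (y : S) : L.j d (L.j x (L.j d (L.j x y))) = L.j d (L.j x y) := by
    simpa only [L.j_assoc] using congrArg (fun t => L.j t y) (L.j_idem (L.j d x))
  constructor
  · simp only [npre, L.j_assoc, hidem]
  · simp only [npre, L.j_assoc, hxdx]
end

section
/- Let (S;∧,∨,→,1) be an algebra of type (2,2,2,0) such that: (1) (S;∧,∨,1) is a co-strongly distributive skew lattice with top 1; (2) y ≤ x→y holds for all x, y ∈ S (natural partial order); and (3) for all x, y, z ∈ S, x ⪯ y→z if and only if x∧y ⪯ z. Then (S;∧,∨,→,1) is a skew Heyting algebra: x→y = (y∨x∨y)→y for all x,y, and whenever y ≤ x, x→y is the greatest element w with y ≤ w satisfying w∧x ≤ y. -/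
open SkewLattice

namespace SkewLattice

variable {S : Type*} {L : SkewLattice S}

/-- The preorder is reflexive. -/
theorem npre_refl (L : SkewLattice S) (x : S) : L.npre x x := by
  simp only [npre, L.j_idem]

/-- In the upset of `y`, an element dominates its `D`-class from both sides. -/
theorem join_eq_of_npre (hcs : L.CoStronglyDistributive) {y e f : S}
    (he : L.nle y e) (hf : L.nle y f) (hfe : L.npre f e) :
    L.j e f = e ∧ L.j f e = e := by
  have hfy : L.m f y = y := by
    have := L.abs4 f y
    rwa [hf.2] at this
  have hyf : L.m y f = y := by
    have := L.abs1 y f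
    rwa [hf.1] at this
  have hr := hcs.1 e f y
  have hl := hcs.2 y f e
  rw [hfy, he.2] at hr
  rw [hyf, he.1] at hl
  have h1 := L.abs1 (L.j e f) e
  have h2 := L.abs4 e (L.j f e)
  rw [hfe] at h1
  rw [← L.j_assoc, hfe] at h2
  exact ⟨h1.symm.trans hr.symm, h2.symm.trans hl.symm⟩

/-- In an upset of a co-strongly distributive skew lattice, the preorder is the natural order. -/
theorem nle_of_npre (hcs : L.CoStronglyDistributive) {y e f : S}
    (he : L.nle y e) (hf : L.nle y f) (hfe : L.npre f e) : L.nle f e :=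
  (join_eq_of_npre hcs he hf hfe).symm

theorem nle_antisymm_s15 {e f : S} (h : L.nle e f) (h' : L.nle f e) : e = f :=
  h'.2.symm.trans h.1

/-- For `y ≤ a`, meeting `a` with `y ∨ x ∨ y` is conjugating `a ∧ x` by `y`. -/
theorem join_meet_join (hcs : L.CoStronglyDistributive) {a y : S} (ha : L.nle y a) (x : S) :
    L.j (L.j y (L.m a x)) y = L.m a (L.j (L.j y x) y) := by
  rw [hcs.1, hcs.2, ha.1, ha.2]

/-- For `y ≤ a`, `a ∧ (y ∨ x ∨ y) ⪯ y` iff `a ∧ x ⪯ y`. -/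
theorem npre_meet_conj_iff (hcs : L.CoStronglyDistributive) {a y : S} (ha : L.nle y a) (x : S) :
    L.npre (L.m a (L.j (L.j y x) y)) y ↔ L.npre (L.m a x) y := by
  have hconj : L.j (L.j y (L.j (L.j y (L.m a x)) y)) y = L.j (L.j y (L.m a x)) y := by
    rw [L.j_assoc y (L.j _ y) y, L.j_assoc _ y y, L.j_idem, ← L.j_assoc, ← L.j_assoc, L.j_idem]
  rw [← join_meet_join hcs ha, npre, npre, hconj]

theorem npre_of_nle {x y : S} (h : L.nle x y) : L.npre x y := by
  rw [npre, h.2, L.j_idem]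

end SkewLattice

/-- a co-strongly distributive skew lattice with top 1 and a binary
operation → satisfying y ≤ x→y and (SHA) is a skew Heyting algebra. -/
theorem stmt_15 {S : Type*} (L : SkewLattice S) (one : S) (h : S → S → S)
    (hcs : L.CoStronglyDistributive) (htop : L.IsTop one)
    (h2 : ∀ x y, L.nle y (h x y))
    (h3 : ∀ x y z, L.npre x (h y z) ↔ L.npre (L.m x y) z) :
    L.IsSkewHeytingImp h := by
  refine ⟨fun x y => ?_, fun x y hyx => ⟨h2 x y, ?_, fun w hw hwx => ?_⟩⟩
  · refine nle_antisymm_s15 (nle_of_npre hcs (h2 _ y) (h2 x y) ?_)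
      (nle_of_npre hcs (h2 x y) (h2 _ y) ?_)
    · rw [h3, npre_meet_conj_iff hcs (h2 x y), ← h3]
      exact npre_refl L _
    · rw [h3, ← npre_meet_conj_iff hcs (h2 _ y), ← h3]
      exact npre_refl L _
  · have hmeet : L.npre (L.m (h x y) x) y := (h3 _ _ _).1 (npre_refl L _)
    have hy : L.m (h x y) x = y := by
      rwa [npre, join_meet_join hcs (h2 x y), hyx.1, hyx.2] at hmeet
    rw [hy]
    exact ⟨L.j_idem y, L.j_idem y⟩
  · exact nle_of_npre hcs (h2 x y) hw ((h3 _ _ _).2 (npre_of_nle hwx))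
end

section
/- Let (S;∧,∨,\\,1) be a dual skew Boolean algebra. Define x→y = y\\x. Then (S;∧,∨,→,1) is a skew Heyting algebra. -/
open SkewLattice

namespace SkewLattice

variable {S : Type*} {L : SkewLattice S} {one : S}

theorem IsTop.m_left (h : L.IsTop one) (x : S) : L.m one x = x := by
  simpa only [(h x).2] using L.abs4 one x

theorem IsTop.m_right (h : L.IsTop one) (x : S) : L.m x one = x := by
  simpa only [(h x).1] using L.abs1 x one

theorem j_right_eq_self_of_m_eq {x y c : S} (h : L.m c x = y) : L.j c y = c := by
  rw [← h, L.abs2]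

theorem j_left_eq_self_of_m_eq {x y c : S} (h : L.m x c = y) : L.j y c = c := by
  rw [← h, L.abs3]

/-- An element whose meet with `x` lies below `y` lies below every complement of `x`
relative to `y`. -/
theorem CoStronglyDistributive.nle_of_m_nle (hcs : L.CoStronglyDistributive)
    (htop : L.IsTop one) {x y c w : S} (hxc : L.j x c = one) (hcx : L.j c x = one)
    (hmxc : L.m x c = y) (hmcx : L.m c x = y) (hw : L.nle (L.m w x) y) : L.nle w c := by
  have hcy := j_right_eq_self_of_m_eq hmcx
  have hyc := j_left_eq_self_of_m_eq hmxc
  constructor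
  · calc L.j w c = L.j (L.m w x) c := by rw [hcs.2, hxc, htop.m_right]
      _ = L.j (L.m w x) (L.j y c) := by rw [hyc]
      _ = c := by rw [← L.j_assoc, hw.1, hyc]
  · calc L.j c w = L.j c (L.m w x) := by rw [hcs.1, hcx, htop.m_right]
      _ = L.j (L.j c y) (L.m w x) := by rw [hcy]
      _ = c := by rw [L.j_assoc, hw.2, hcy]

/-- Relative complements are unique. -/
theorem CoStronglyDistributive.complement_unique (hcs : L.CoStronglyDistributive)
    (htop : L.IsTop one) {x y c d : S} (hcx : L.j c x = one) (hxd : L.j x d = one)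
    (hmcx : L.m c x = y) (hmxd : L.m x d = y) : c = d := by
  calc c = L.j c (L.m x d) := by rw [hmxd, j_right_eq_self_of_m_eq hmcx]
    _ = L.j c d := by rw [hcs.1, hcx, htop.m_left]
    _ = L.j (L.m c x) d := by rw [hcs.2, hxd, htop.m_right]
    _ = d := by rw [hmcx, j_left_eq_self_of_m_eq hmxd]

end SkewLattice

/-- a dual skew Boolean algebra is a skew Heyting algebra via
x→y = y\\x. -/
theorem stmt_17 {S : Type*} (L : SkewLattice S) (one : S) (dd : S → S → S)
    (hcs : L.CoStronglyDistributive) (htop : L.IsTop one)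
    (hd1 : ∀ x y : S, L.j (L.j (L.j y x) y) (dd y x) = one ∧
      L.j (dd y x) (L.j (L.j y x) y) = one)
    (hd2 : ∀ x y : S, L.m (L.j (L.j y x) y) (dd y x) = y ∧
      L.m (dd y x) (L.j (L.j y x) y) = y) :
    L.IsSkewHeytingImp (fun x y => dd y x) := by
  constructor
  · intro x y
    have hX : L.j (L.j y (L.j (L.j y x) y)) y = L.j (L.j y x) y := by
      simp only [L.j_assoc, L.j_idem]
      rw [← L.j_assoc, L.j_idem]
    have h1 := (hd1 (L.j (L.j y x) y) y).1
    have h2 := (hd2 (L.j (L.j y x) y) y).1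
    rw [hX] at h1 h2
    exact hcs.complement_unique htop (hd1 x y).2 h1 (hd2 x y).2 h2
  · intro x y hyx
    have hX : L.j (L.j y x) y = x := by rw [hyx.1, hyx.2]
    have h1 := hd1 x y
    have h2 := hd2 x y
    rw [hX] at h1 h2
    refine ⟨⟨j_left_eq_self_of_m_eq h2.1, j_right_eq_self_of_m_eq h2.2⟩, ?_, ?_⟩
    · simp only [h2.2]
      exact ⟨L.j_idem y, L.j_idem y⟩
    · intro w _ hw
      exact hcs.nle_of_m_nle htop h1.1 h1.2 h2.1 h2.2 hw
end
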